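/- Let f(x) = Σ_{i=0}^{n} a_i x^i and g(x) = Σ_{j=0}^{m} b_j x^j be real polynomials with n ≥ 1 and m ≥ 1, and suppose that not all of the coefficients a_0, a_2, …, a_{2[n/2]}, b_0, b_2, …, b_{2[m/2]} are zero. Then the averaged function F₀ has at most [n/2] + [m/2] + 1 zeros in the interval (0, ∞). -/

import Mathlib

open Real intervalIntegral Finset

theorem signVariations_add_one_le_card_support :
    ∀ (k : ℕ) (P : Polynomial ℝ), P ≠ 0 → P.support.card = k → P.signVariations + 1 ≤ k := by
  intro k
  induction k with
  | zero =>
    intro P hP hk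
    exact absurd (Polynomial.card_support_eq_zero.1 hk) hP
  | succ k ih =>
    intro P hP hk
    by_cases h : P.eraseLead = 0
    · have h2 := P.eraseLead_add_monomial_natDegree_leadingCoeff
      rw [h, zero_add] at h2
      rw [← h2, Polynomial.signVariations_monomial]
      omega
    · have h1 := ih P.eraseLead h (Polynomial.card_support_eraseLead' hk)
      have h2 := P.signVariations_le_eraseLead_succ
      omega

theorem card_pos_zeros_lt_card_support (P : Polynomial ℝ) (hP : P ≠ 0) (S : Finset ℝ)
    (hS : ∀ r ∈ S, 0 < r ∧ P.eval r = 0) : S.card + 1 ≤ P.support.card := by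
  refine le_trans ?_ (signVariations_add_one_le_card_support _ P hP rfl)
  refine Nat.add_le_add_right (le_trans ?_ P.roots_countP_pos_le_signVariations) 1
  rw [Multiset.countP_eq_card_filter]
  have hle : S.val ≤ P.roots.filter (0 < ·) := by
    rw [Multiset.le_iff_subset S.nodup]
    intro r hr
    obtain ⟨h0, h1⟩ := hS r hr
    exact Multiset.mem_filter.2 ⟨(Polynomial.mem_roots hP).2 h1, h0⟩
  exact Multiset.card_le_card hle

theorem integral_cos_pow_mul_eq_zero_of_odd {w : ℝ → ℝ}
    (hper : ∀ θ, w (θ + π) = w θ) {k : ℕ} (hk : Odd k) :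
    ∫ θ in (0:ℝ)..(2 * π), Real.cos θ ^ k * w θ = 0 := by
  have hp : Function.Periodic (fun θ => Real.cos θ ^ k * w θ) (2 * π) := by
    intro θ
    simp only [Real.cos_add_two_pi]
    rw [show θ + 2 * π = (θ + π) + π by ring, hper, hper]
  have h1 := hp.intervalIntegral_add_eq 0 π
  have h2 : ∫ θ in (0:ℝ)..(2 * π), (fun θ => Real.cos θ ^ k * w θ) (θ + π) =
      ∫ θ in (0 + π)..(2 * π + π), Real.cos θ ^ k * w θ :=
    intervalIntegral.integral_comp_add_right (fun θ => Real.cos θ ^ k * w θ) π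
  simp only [Real.cos_add_pi, hk.neg_pow, hper, neg_mul, intervalIntegral.integral_neg] at h2
  rw [zero_add] at h1
  rw [zero_add, add_comm (2 * π) π] at h2
  linarith

theorem integral_cos_pow_mul_pos_of_even {w : ℝ → ℝ} (hw : Continuous w)
    (hw0 : ∀ θ, 0 ≤ w θ) (hpos : 0 < w (π / 4)) {k : ℕ} (hk : Even k) :
    0 < ∫ θ in (0:ℝ)..(2 * π), Real.cos θ ^ k * w θ := by
  refine intervalIntegral.integral_pos (by positivity) (by fun_prop)
    (fun θ _ => mul_nonneg (hk.pow_nonneg _) (hw0 θ))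
    ⟨π / 4, ⟨by positivity, by linarith [Real.pi_pos]⟩, mul_pos (pow_pos ?_ _) hpos⟩
  rw [Real.cos_pi_div_four]
  positivity

theorem Real.sign_mul_self_eq_abs (x : ℝ) : Real.sign x * x = |x| := by
  rcases lt_trichotomy x 0 with h | h | h
  · rw [Real.sign_of_neg h, abs_of_neg h]; ring
  · simp [h]
  · rw [Real.sign_of_pos h, abs_of_pos h]; ring

theorem integral_averaged_integrand (n m : ℕ) (a b : ℕ → ℝ) (r : ℝ) :
    ∫ θ in (0:ℝ)..(2 * π),
        ((∑ i ∈ Finset.range (n + 1), a i * (r * Real.cos θ) ^ i) * r * (Real.sin θ) ^ 2 +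
          Real.sign (Real.sin θ) * Real.sin θ *
            ∑ j ∈ Finset.range (m + 1), b j * (r * Real.cos θ) ^ j) =
      (∑ i ∈ Finset.range (n + 1),
        a i * (∫ θ in (0:ℝ)..(2 * π), Real.cos θ ^ i * Real.sin θ ^ 2) * r ^ (i + 1)) +
      ∑ j ∈ Finset.range (m + 1),
        b j * (∫ θ in (0:ℝ)..(2 * π), Real.cos θ ^ j * |Real.sin θ|) * r ^ j := by
  have h : ∀ θ : ℝ,
      ((∑ i ∈ Finset.range (n + 1), a i * (r * Real.cos θ) ^ i) * r * (Real.sin θ) ^ 2 +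
          Real.sign (Real.sin θ) * Real.sin θ *
            ∑ j ∈ Finset.range (m + 1), b j * (r * Real.cos θ) ^ j) =
      (∑ i ∈ Finset.range (n + 1), (a i * r ^ (i + 1)) * (Real.cos θ ^ i * Real.sin θ ^ 2)) +
      ∑ j ∈ Finset.range (m + 1), (b j * r ^ j) * (Real.cos θ ^ j * |Real.sin θ|) := by
    intro θ
    rw [Real.sign_mul_self_eq_abs, Finset.sum_mul, Finset.sum_mul, Finset.mul_sum]
    congr 1 <;> refine Finset.sum_congr rfl fun i _ => ?_ <;> ring
  simp only [h]
  rw [intervalIntegral.integral_add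
      (Continuous.intervalIntegrable (by fun_prop) _ _)
      (Continuous.intervalIntegrable (by fun_prop) _ _),
    intervalIntegral.integral_finsetSum
      (fun i _ => Continuous.intervalIntegrable (by fun_prop) _ _),
    intervalIntegral.integral_finsetSum
      (fun i _ => Continuous.intervalIntegrable (by fun_prop) _ _)]
  simp only [intervalIntegral.integral_const_mul]
  congr 1 <;> refine Finset.sum_congr rfl fun i _ => ?_ <;> ring

theorem averaged_function_zeros_bound (n m : ℕ) (hn : 1 ≤ n) (hm : 1 ≤ m)
    (a b : ℕ → ℝ)
    (hne : (∃ i ≤ n / 2, a (2 * i) ≠ 0) ∨ (∃ j ≤ m / 2, b (2 * j) ≠ 0))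
    (F₀ : ℝ → ℝ)
    (hF₀ : F₀ = fun r => (1 / (2 * π)) *
      ∫ θ in (0:ℝ)..(2 * π),
        ((∑ i ∈ Finset.range (n + 1), a i * (r * Real.cos θ) ^ i) * r * (Real.sin θ) ^ 2 +
          Real.sign (Real.sin θ) * Real.sin θ *
            ∑ j ∈ Finset.range (m + 1), b j * (r * Real.cos θ) ^ j)) :
    ∀ S : Finset ℝ, (∀ r ∈ S, 0 < r ∧ F₀ r = 0) → S.card ≤ n / 2 + m / 2 + 1 := by
  intro S hS
  have h4 : 0 < Real.sin (π / 4) := by rw [Real.sin_pi_div_four]; positivity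
  obtain ⟨A, hA⟩ : ∃ A : ℕ → ℝ, A = fun i =>
    ∫ θ in (0:ℝ)..(2 * π), Real.cos θ ^ i * Real.sin θ ^ 2 := ⟨_, rfl⟩
  obtain ⟨B, hB⟩ : ∃ B : ℕ → ℝ, B = fun j =>
    ∫ θ in (0:ℝ)..(2 * π), Real.cos θ ^ j * |Real.sin θ| := ⟨_, rfl⟩
  have hA0 : ∀ i, Odd i → A i = 0 := fun i hi => by
    rw [hA]; exact integral_cos_pow_mul_eq_zero_of_odd (w := fun θ => Real.sin θ ^ 2)
      (fun θ => by simp [Real.sin_add_pi]) hi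
  have hB0 : ∀ i, Odd i → B i = 0 := fun i hi => by
    rw [hB]; exact integral_cos_pow_mul_eq_zero_of_odd (w := fun θ => |Real.sin θ|)
      (fun θ => by simp [Real.sin_add_pi]) hi
  have hA1 : ∀ i, Even i → 0 < A i := fun i hi => by
    rw [hA]; exact integral_cos_pow_mul_pos_of_even (w := fun θ => Real.sin θ ^ 2)
      (by fun_prop) (fun θ => by positivity) (by positivity) hi
  have hB1 : ∀ i, Even i → 0 < B i := fun i hi => by
    rw [hB]; exact integral_cos_pow_mul_pos_of_even (w := fun θ => |Real.sin θ|)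
      (by fun_prop) (fun θ => by positivity) (by positivity) hi
  obtain ⟨P, hP⟩ : ∃ P : Polynomial ℝ, P =
    (∑ i ∈ Finset.range (n + 1), Polynomial.monomial (i + 1) (a i * A i)) +
      ∑ j ∈ Finset.range (m + 1), Polynomial.monomial j (b j * B j) := ⟨_, rfl⟩
  have hcoeff_odd : ∀ i, P.coeff (2 * i + 1) = if i ≤ n / 2 then a (2 * i) * A (2 * i) else 0 := by
    intro i
    simp only [hP, Polynomial.coeff_add, Polynomial.finsetSum_coeff, Polynomial.coeff_monomial,
      Nat.add_right_cancel_iff, Finset.sum_ite_eq', Finset.mem_range,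
      hB0 (2 * i + 1) ⟨i, rfl⟩, mul_zero, ite_self, add_zero]
    exact if_congr (by omega) rfl rfl
  have hcoeff_even : ∀ j, P.coeff (2 * j) = if j ≤ m / 2 then b (2 * j) * B (2 * j) else 0 := by
    intro j
    have hz : ∑ i ∈ Finset.range (n + 1), (if i + 1 = 2 * j then a i * A i else 0) = 0 := by
      refine Finset.sum_eq_zero fun i _ => ?_
      split_ifs with h
      · rw [hA0 i ⟨j - 1, by omega⟩, mul_zero]
      · rfl
    simp only [hP, Polynomial.coeff_add, Polynomial.finsetSum_coeff, Polynomial.coeff_monomial,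
      hz, Finset.sum_ite_eq', Finset.mem_range, zero_add]
    exact if_congr (by omega) rfl rfl
  have hP0 : P ≠ 0 := by
    intro h
    rcases hne with ⟨i, hi, hai⟩ | ⟨j, hj, hbj⟩
    · have := hcoeff_odd i
      rw [h, if_pos hi, Polynomial.coeff_zero] at this
      exact mul_ne_zero hai (hA1 _ (even_two_mul i)).ne' this.symm
    · have := hcoeff_even j
      rw [h, if_pos hj, Polynomial.coeff_zero] at this
      exact mul_ne_zero hbj (hB1 _ (even_two_mul j)).ne' this.symm
  have hsupp : P.support ⊆ (Finset.range (n / 2 + 1)).image (fun i => 2 * i + 1) ∪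
      (Finset.range (m / 2 + 1)).image (fun j => 2 * j) := by
    intro k hk
    rw [Polynomial.mem_support_iff] at hk
    simp only [Finset.mem_union, Finset.mem_image, Finset.mem_range]
    rcases Nat.even_or_odd' k with ⟨j, rfl | rfl⟩
    · rw [hcoeff_even] at hk
      exact Or.inr ⟨j, Nat.lt_succ_of_le (by by_contra h; simp [h] at hk), rfl⟩
    · rw [hcoeff_odd] at hk
      exact Or.inl ⟨j, Nat.lt_succ_of_le (by by_contra h; simp [h] at hk), rfl⟩
  have hcard : P.support.card ≤ (n / 2 + 1) + (m / 2 + 1) :=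
    (Finset.card_le_card hsupp).trans <| (Finset.card_union_le _ _).trans <|
      add_le_add (Finset.card_image_le.trans (by simp)) (Finset.card_image_le.trans (by simp))
  have hroots := card_pos_zeros_lt_card_support P hP0 S fun r hr => by
    obtain ⟨h0, h1⟩ := hS r hr
    refine ⟨h0, ?_⟩
    rw [hF₀] at h1
    have h2 := (mul_eq_zero.1 h1).resolve_left (by positivity)
    rw [integral_averaged_integrand] at h2
    simpa [hP, Polynomial.eval_finsetSum, hA, hB] using h2
  omega
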